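/- Let (X, h, Z) be a fiberwise essentially minimal zero-dimensional system with associated map ψ : X → Z. Then for every x ∈ X, the closure of the h-orbit { h^n(x) : n ∈ ℤ } contains exactly one point of Z, namely ψ(x), and contains exactly one point of h⁻¹(Z), namely h⁻¹(ψ(x)). -/

import Mathlib

open Set

/-- A minimal set for the restriction of the homeomorphism `h` to the invariant set `A`:
a nonempty closed `h`-invariant subset of `A` with no nonempty proper closed
`h`-invariant subset. -/
def IsMinimalSubsetOf {X : Type*} [TopologicalSpace X] (h : X ≃ₜ X) (A Y : Set X) : Prop :=
  Y.Nonempty ∧ IsClosed Y ∧ Y ⊆ A ∧ h '' Y = Y ∧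
    ∀ Y' ⊆ Y, Y'.Nonempty → IsClosed Y' → h '' Y' = Y' → Y' = Y

/-- `(X, h, Z)` is a fiberwise essentially minimal zero-dimensional system with
associated map `ψ`. -/
def IsFiberwiseEssentiallyMinimal {X : Type*} [TopologicalSpace X] (h : X ≃ₜ X)
    (Z : Set X) (ψ : X → X) : Prop :=
  IsClosed Z ∧ Continuous ψ ∧ (∀ x, ψ x ∈ Z) ∧ (∀ z ∈ Z, ψ z = z) ∧
    (∀ x, ψ (h x) = ψ x) ∧
    ∀ z ∈ Z, ∃ Y, IsMinimalSubsetOf h (ψ ⁻¹' {z}) Y ∧ z ∈ Y ∧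
      ∀ Y', IsMinimalSubsetOf h (ψ ⁻¹' {z}) Y' → Y' = Y

/-- The full `h`-orbit `{ hⁿ(x) : n ∈ ℤ }` of a point. -/
def Orbit {X : Type*} [TopologicalSpace X] (h : X ≃ₜ X) (x : X) : Set X :=
  { y | ∃ n : ℤ, y = (h.toEquiv ^ n) x }

/-- A set is fixed by a homeomorphism iff membership is preserved and reflected by it. -/
theorem image_eq_self_iff_forall_mem {X : Type*} [TopologicalSpace X] (h : X ≃ₜ X)
    (Y : Set X) : h '' Y = Y ↔ ∀ y, h y ∈ Y ↔ y ∈ Y := by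
  constructor
  · intro hY y
    conv_lhs => rw [← hY]
    exact h.injective.mem_set_image
  · intro hY
    ext y
    obtain ⟨w, rfl⟩ := h.surjective y
    rw [h.injective.mem_set_image, hY]

/-- Every nonempty closed invariant subset of a compact space contains a minimal set. -/
theorem exists_isMinimalSubsetOf {X : Type*} [TopologicalSpace X] [CompactSpace X]
    (h : X ≃ₜ X) {C : Set X} (hne : C.Nonempty) (hC : IsClosed C) (hinv : h '' C = C) :
    ∃ Y, IsMinimalSubsetOf h C Y := by
  obtain ⟨Y, hYC, hY⟩ := zorn_superset_nonempty
    {Y : Set X | Y.Nonempty ∧ IsClosed Y ∧ h '' Y = Y} (fun c hc hchain hcne => by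
      refine ⟨⋂₀ c, ⟨?_, isClosed_sInter fun Y hY => (hc hY).2.1, ?_⟩,
        fun Y hY => sInter_subset_of_mem hY⟩
      · have : Nonempty c := hcne.to_subtype
        exact IsCompact.nonempty_sInter_of_directed_nonempty_isCompact_isClosed
          (fun A hA B hB => (hchain.total hA hB).elim
            (fun hAB => ⟨A, hA, Subset.rfl, hAB⟩) (fun hBA => ⟨B, hB, hBA, Subset.rfl⟩))
          (fun Y hY => (hc hY).1) (fun Y hY => (hc hY).2.1.isCompact)
          (fun Y hY => (hc hY).2.1)
      · rw [image_eq_self_iff_forall_mem]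
        intro y
        simp only [mem_sInter]
        exact forall₂_congr fun Y hY =>
          (image_eq_self_iff_forall_mem h Y).1 (hc hY).2.2 y)
    C ⟨hne, hC, hinv⟩
  exact ⟨Y, hY.prop.1, hY.prop.2.1, hYC, hY.prop.2.2, fun Y' hsub hne' hcl' hinv' =>
    hsub.antisymm (hY.le_of_le ⟨hne', hcl', hinv'⟩ hsub)⟩

theorem zpow_one_add_apply {X : Type*} [TopologicalSpace X] (h : X ≃ₜ X) (n : ℤ) (x : X) :
    (h.toEquiv ^ (1 + n)) x = h ((h.toEquiv ^ n) x) := by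
  rw [zpow_add, zpow_one]
  rfl

theorem image_orbit {X : Type*} [TopologicalSpace X] (h : X ≃ₜ X) (x : X) :
    h '' Orbit h x = Orbit h x := by
  rw [image_eq_self_iff_forall_mem]
  intro y
  constructor
  · rintro ⟨n, hn⟩
    refine ⟨n - 1, h.injective ?_⟩
    rw [hn, ← zpow_one_add_apply, add_sub_cancel]
  · rintro ⟨n, rfl⟩
    exact ⟨1 + n, (zpow_one_add_apply h n x).symm⟩

theorem apply_eq_of_mem_closure_orbit {X : Type*} [TopologicalSpace X] [T2Space X]
    {h : X ≃ₜ X} {ψ : X → X} (hψ : Continuous ψ) (hψh : ∀ x, ψ (h x) = ψ x) {x y : X}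
    (hy : y ∈ closure (Orbit h x)) : ψ y = ψ x := by
  have hcl : IsClosed {y | ψ y = ψ x} := isClosed_eq hψ continuous_const
  refine closure_minimal ?_ hcl hy
  rintro _ ⟨n, rfl⟩
  change ψ ((h.toEquiv ^ n) x) = ψ x
  induction n with
  | zero => rfl
  | succ n ih => rw [add_comm, zpow_one_add_apply, hψh, ih]
  | pred n ih => rw [← hψh, ← zpow_one_add_apply, add_sub_cancel, ih]

/-- For a fiberwise essentially minimal zero-dimensional system, the closure of the
orbit of any `x` meets `Z` exactly in `ψ(x)` and meets `h⁻¹(Z)` exactly in `h⁻¹(ψ(x))`. -/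
theorem stmt7 {X : Type*} [TopologicalSpace X] [CompactSpace X]
    [TopologicalSpace.MetrizableSpace X] [TotallyDisconnectedSpace X]
    (h : X ≃ₜ X) (Z : Set X) (ψ : X → X)
    (hfem : IsFiberwiseEssentiallyMinimal h Z ψ) (x : X) :
    closure (Orbit h x) ∩ Z = {ψ x} ∧
      closure (Orbit h x) ∩ (⇑h ⁻¹' Z) = {h.symm (ψ x)} := by
  obtain ⟨-, hψ, hψZ, hψid, hψh, hmin⟩ := hfem
  have hinv : h '' closure (Orbit h x) = closure (Orbit h x) := by
    rw [h.image_closure, image_orbit]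
  have hfib : closure (Orbit h x) ⊆ ψ ⁻¹' {ψ x} :=
    fun y hy => apply_eq_of_mem_closure_orbit hψ hψh hy
  have hmem : ψ x ∈ closure (Orbit h x) := by
    obtain ⟨Y, -, hzY, huniq⟩ := hmin (ψ x) (hψZ x)
    obtain ⟨Y', hne, hcl, hsub, hY', hY'min⟩ := exists_isMinimalSubsetOf h
      (C := closure (Orbit h x)) ⟨x, subset_closure ⟨0, rfl⟩⟩ isClosed_closure hinv
    have hYY : Y' = Y := huniq Y' ⟨hne, hcl, hsub.trans hfib, hY', hY'min⟩
    exact hsub (hYY ▸ hzY)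
  have hinter : closure (Orbit h x) ∩ Z = {ψ x} := by
    refine Subset.antisymm ?_ (singleton_subset_iff.2 ⟨hmem, hψZ x⟩)
    rintro z ⟨hz, hzZ⟩
    exact (hψid z hzZ).symm.trans (hfib hz)
  refine ⟨hinter, ?_⟩
  ext y
  rw [mem_inter_iff, mem_preimage, ← (image_eq_self_iff_forall_mem h _).1 hinv,
    ← mem_inter_iff, hinter, mem_singleton_iff, mem_singleton_iff]
  exact h.toEquiv.eq_symm_apply.symm
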